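/- Let α be irrational and suppose that either Σ_{n≥1} 1/log(a_n) < ∞ (which entails a_n ≥ 2 for all n), or there exist constants C > 0 and γ > 0 with q_n ≥ C·exp(n^{2+γ}) for every n. Then for Haar-almost every x ∈ T one has lim_{j→∞} (1/‖x + jα‖) / (Σ_{i=0}^{j−1} 1/‖x + iα‖) = 0. -/

import Mathlib

/-- The complete quotients of the continued fraction expansion of `α`
(`cfQuot α 0 = α`, and `cfQuot α (n+1)` is the inverse of the fractional part
of `cfQuot α n`). -/
noncomputable def cfQuot (α : ℝ) : ℕ → ℝ
  | 0 => α
  | n + 1 => (cfQuot α n - ⌊cfQuot α n⌋)⁻¹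

/-- The partial quotients `aₙ` of the continued fraction expansion
`α = [a₀; a₁, a₂, …]` (as natural numbers; for irrational `α` and `n ≥ 1`
one has `cfa α n ≥ 1`). -/
noncomputable def cfa (α : ℝ) (n : ℕ) : ℕ := (⌊cfQuot α n⌋).toNat

/-- The denominators `qₙ` of the convergents `pₙ/qₙ` of `α`:
`q₀ = 1`, `q₁ = a₁` and `q_{n+2} = a_{n+2} q_{n+1} + q_n`. -/
noncomputable def cfq (α : ℝ) : ℕ → ℕ
  | 0 => 1
  | 1 => cfa α 1
  | n + 2 => cfa α (n + 2) * cfq α (n + 1) + cfq α n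

/-- The numerators `pₙ` of the convergents `pₙ/qₙ` of `α`:
`p₀ = a₀`, `p₁ = a₁ a₀ + 1` and `p_{n+2} = a_{n+2} p_{n+1} + pₙ`. -/
noncomputable def cfp (α : ℝ) : ℕ → ℤ
  | 0 => ⌊α⌋
  | 1 => (cfa α 1 : ℤ) * ⌊α⌋ + 1
  | n + 2 => (cfa α (n + 2) : ℤ) * cfp α (n + 1) + cfp α n

/-- `ρₙ = qₙ α − pₙ`. -/
noncomputable def cfrho (α : ℝ) (n : ℕ) : ℝ := (cfq α n : ℝ) * α - (cfp α n : ℝ)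

/-- `λ⁽ⁿ⁾ = |ρₙ| = ‖qₙ α‖`, the distance from `qₙ α` to the nearest integer. -/
noncomputable def cflam (α : ℝ) (n : ℕ) : ℝ := |cfrho α n|

theorem log_le_sum_range_inv {c : ℝ} (hc : 0 < c) (k : ℕ) :
    Real.log ((k + c) / c) ≤ ∑ l ∈ Finset.range k, ((l : ℝ) + c)⁻¹ := by
  induction k with
  | zero => simp [hc.ne']
  | succ k ih =>
    rw [Finset.sum_range_succ]
    have hk : 0 < (k : ℝ) + c := by positivity
    have h1 : ((k + 1 : ℕ) + c) / c = ((k + c) / c) * (1 + (k + c)⁻¹) := by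
      push_cast; field_simp; ring
    rw [h1, Real.log_mul (by positivity) (by positivity)]
    have := Real.log_le_sub_one_of_pos (x := 1 + ((k : ℝ) + c)⁻¹) (by positivity)
    linarith

theorem sum_Ico_inv_le_two_mul_log {a b : ℕ} (ha : 1 ≤ a) (hab : a ≤ b) :
    ∑ j ∈ Finset.Ico a b, (j : ℝ)⁻¹ ≤ 2 * Real.log ((b : ℝ) / a) := by
  induction b, hab using Nat.le_induction with
  | base =>
    have : (a : ℝ) ≠ 0 := by positivity
    simp [this]
  | succ b hab ih =>
    rw [Finset.sum_Ico_succ_top hab]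
    have ha' : (1 : ℝ) ≤ a := by exact_mod_cast ha
    have hb : (1 : ℝ) ≤ b := by exact_mod_cast ha.trans hab
    have h1 : ((b + 1 : ℕ) : ℝ) / a = (b / a) * ((b + 1) / b) := by
      push_cast; field_simp
    rw [h1, Real.log_mul (by positivity) (by positivity)]
    have h2 := Real.one_sub_inv_le_log_of_pos (x := ((b : ℝ) + 1) / b) (by positivity)
    have h3 : 1 - (((b : ℝ) + 1) / b)⁻¹ = ((b : ℝ) + 1)⁻¹ := by field_simp; ring
    have h4 : (b : ℝ)⁻¹ ≤ 2 * ((b : ℝ) + 1)⁻¹ := by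
      rw [← div_eq_mul_inv, inv_eq_one_div, div_le_div_iff₀ (by positivity) (by positivity)]
      linarith
    linarith

theorem UnitAddCircle.norm_coe_le_of_eq_intCast_add {y t : ℝ} (z : ℤ) (h : y = z + t) :
    ‖(y : UnitAddCircle)‖ ≤ |t| := by
  rw [UnitAddCircle.norm_eq, h]
  have := round_le (z + t : ℝ) z
  simpa using this

/-- `q` consecutive points of a rotation well approximated by `p / q` are so well distributed that
their reciprocal distances to `0` sum up to at least `q log q`, up to constants. -/
theorem mul_log_le_sum_range_inv_norm {α : ℝ} {q : ℕ} {p : ℤ} (hq : 1 ≤ q)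
    (hpq : IsCoprime p (q : ℤ)) (hα : |q * α - p| ≤ 1 / q) (x : UnitAddCircle)
    (hx : ∀ i : ℕ, x + i • (α : UnitAddCircle) ≠ 0) :
    q * Real.log ((q + 2) / 2) ≤ ∑ i ∈ Finset.range q, ‖x + i • (α : UnitAddCircle)‖⁻¹ := by
  obtain ⟨y, rfl⟩ := QuotientAddGroup.mk_surjective x
  change ∀ i : ℕ, (y : UnitAddCircle) + _ ≠ 0 at hx
  change _ ≤ ∑ i ∈ Finset.range q, ‖(y : UnitAddCircle) + i • (α : UnitAddCircle)‖⁻¹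
  have hq0 : (0 : ℝ) < q := by exact_mod_cast hq
  have hqz : (0 : ℤ) < q := by exact_mod_cast hq
  set m : ℤ := ⌊q * y⌋ with hm
  set l : ℕ → ℕ := fun i => ((m + i * p) % q).toNat with hl
  have hlz : ∀ i, (l i : ℤ) = (m + i * p) % q := fun i =>
    Int.toNat_of_nonneg (Int.emod_nonneg _ hqz.ne')
  have hlt : ∀ i, l i < q := fun i => by
    have := Int.emod_lt_of_pos (m + i * p) hqz
    rw [← hlz] at this
    exact_mod_cast this
  have hinj : Set.InjOn l (Finset.range q) := by
    intro i hi j hj hij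
    have h1 : (m + i * p) % q = (m + j * p) % q := by rw [← hlz, ← hlz, hij]
    have h2 : (q : ℤ) ∣ ((i : ℤ) - j) * p := by
      have h3 := Int.ModEq.dvd (n := q) h1.symm
      rwa [add_sub_add_left_eq_sub, ← sub_mul] at h3
    have h4 : (q : ℤ) ∣ (i : ℤ) - j := hpq.symm.dvd_of_dvd_mul_right h2
    simp only [Finset.coe_range, Set.mem_Iio] at hi hj
    have h5 := Int.eq_zero_of_abs_lt_dvd h4 (by rw [abs_lt]; constructor <;> omega)
    omega
  have himg : (Finset.range q).image l = Finset.range q := by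
    apply Finset.eq_of_subset_of_card_le
    · intro a ha
      obtain ⟨i, -, rfl⟩ := Finset.mem_image.1 ha
      exact Finset.mem_range.2 (hlt i)
    · rw [Finset.card_image_of_injOn hinj]
  have hterm : ∀ i ∈ Finset.range q,
      q * ((l i : ℝ) + 2)⁻¹ ≤ ‖(y : UnitAddCircle) + i • (α : UnitAddCircle)‖⁻¹ := by
    intro i hi
    have hiq : (i : ℝ) ≤ q := by exact_mod_cast (Finset.mem_range.1 hi).le
    have hpos := norm_pos_iff.2 (hx i)
    have hle : ‖(y : UnitAddCircle) + i • (α : UnitAddCircle)‖ ≤ ((l i : ℝ) + 2) / q := by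
      have hcoe : (y : UnitAddCircle) + i • (α : UnitAddCircle) = ((y + i * α : ℝ) : UnitAddCircle) := by
        simp
      have hz : ((m + i * p : ℤ) : ℝ) = (l i : ℝ) + q * ((m + i * p) / q : ℤ) := by
        have := Int.emod_add_mul_ediv (m + i * p) q
        rw [← hlz] at this
        exact_mod_cast this.symm
      push_cast at hz
      rw [hcoe]
      refine (UnitAddCircle.norm_coe_le_of_eq_intCast_add ((m + i * p) / q : ℤ)
        (t := (l i + (q * y - m) + i * (q * α - p)) / q) ?_).trans ?_
      · field_simp
        linarith
      · rw [abs_div, abs_of_pos hq0]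
        gcongr
        have h1 := Int.floor_le (q * y)
        have h2 := Int.lt_floor_add_one (q * y)
        have h3 : |(i : ℝ) * (q * α - p)| ≤ 1 := by
          rw [abs_mul, Nat.abs_cast]
          calc (i : ℝ) * |q * α - p| ≤ q * (1 / q) := by gcongr
            _ = 1 := by field_simp
        have h4 : |(l i : ℝ) + (q * y - m)| ≤ l i + 1 := by
          have h5 : (0 : ℝ) ≤ l i := by positivity
          rw [abs_of_nonneg (by rw [hm]; linarith)]
          linarith
        linarith [abs_add_le ((l i : ℝ) + (q * y - m)) (i * (q * α - p))]
    calc q * ((l i : ℝ) + 2)⁻¹ = (((l i : ℝ) + 2) / q)⁻¹ := by rw [inv_div, div_eq_mul_inv]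
      _ ≤ _ := inv_anti₀ hpos hle
  calc q * Real.log ((q + 2) / 2) ≤ q * ∑ a ∈ Finset.range q, ((a : ℝ) + 2)⁻¹ := by
        gcongr
        exact log_le_sum_range_inv two_pos q
    _ = ∑ i ∈ Finset.range q, q * ((l i : ℝ) + 2)⁻¹ := by
        rw [← Finset.mul_sum]
        conv_lhs => rw [← himg, Finset.sum_image hinj]
    _ ≤ _ := Finset.sum_le_sum hterm
theorem mul_mul_log_le_sum_range_inv_norm {α : ℝ} {q : ℕ} {p : ℤ} (hq : 1 ≤ q)
    (hpq : IsCoprime p (q : ℤ)) (hα : |q * α - p| ≤ 1 / q) (x : UnitAddCircle)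
    (hx : ∀ i : ℕ, x + i • (α : UnitAddCircle) ≠ 0) (k : ℕ) :
    k * (q * Real.log ((q + 2) / 2)) ≤
      ∑ i ∈ Finset.range (k * q), ‖x + i • (α : UnitAddCircle)‖⁻¹ := by
  induction k with
  | zero => simp
  | succ k ih =>
    rw [Nat.succ_mul, Finset.sum_range_add]
    have h := mul_log_le_sum_range_inv_norm hq hpq hα (x + (k * q) • (α : UnitAddCircle))
      (fun i => by simpa only [add_assoc, ← add_nsmul] using hx (k * q + i))
    simp only [add_assoc, ← add_nsmul] at h ⊢
    push_cast
    linarith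

theorem mul_log_le_sum_range_inv_norm_of_le {α : ℝ} {q : ℕ} {p : ℤ} (hq : 1 ≤ q)
    (hpq : IsCoprime p (q : ℤ)) (hα : |q * α - p| ≤ 1 / q) (x : UnitAddCircle)
    (hx : ∀ i : ℕ, x + i • (α : UnitAddCircle) ≠ 0) {j : ℕ} (hj : q ≤ j) (hq4 : 4 ≤ q) :
    j * Real.log q / 4 ≤ ∑ i ∈ Finset.range j, ‖x + i • (α : UnitAddCircle)‖⁻¹ := by
  have hq4' : (4 : ℝ) ≤ q := by exact_mod_cast hq4
  have hlog : Real.log q / 2 ≤ Real.log ((q + 2) / 2) := by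
    have h1 : Real.log q ≤ Real.log (((q + 2) / 2) ^ 2) :=
      Real.log_le_log (by linarith) (by nlinarith)
    rw [Real.log_pow] at h1
    push_cast at h1
    linarith
  have hk : (j : ℝ) / 2 ≤ (j / q : ℕ) * q := by
    have h1 := Nat.div_add_mod j q
    have h2 := Nat.mod_lt j hq
    have h3 : 1 ≤ j / q := (Nat.one_le_div_iff hq).2 hj
    have h4 : j ≤ 2 * (j / q * q) := by nlinarith
    have h5 : (j : ℝ) ≤ 2 * ((j / q : ℕ) * q) := by exact_mod_cast h4
    linarith
  have hlog0 : 0 ≤ Real.log q := Real.log_nonneg (by linarith)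
  calc j * Real.log q / 4 = (j : ℝ) / 2 * (Real.log q / 2) := by ring
    _ ≤ ((j / q : ℕ) * q) * Real.log ((q + 2) / 2) := by gcongr
    _ = (j / q : ℕ) * (q * Real.log ((q + 2) / 2)) := by ring
    _ ≤ _ := mul_mul_log_le_sum_range_inv_norm hq hpq hα x hx _
    _ ≤ _ := Finset.sum_le_sum_of_subset_of_nonneg
      (Finset.range_subset_range.2 (Nat.div_mul_le_self j q)) fun _ _ _ => by positivity

/-- If `q • θ` is close to `0`, then the points `x + (j - m q) • θ` are close to `x + j • θ`. -/
theorem sum_range_inv_add_le_sum_range_inv_norm {x θ : UnitAddCircle} {q k j : ℕ} {δ : ℝ}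
    (hq : 1 ≤ q) (hθ : ‖q • θ‖ ≤ δ) (hkj : k * q ≤ j) (hx : ∀ i : ℕ, x + i • θ ≠ 0) :
    ∑ m ∈ Finset.range k, (‖x + j • θ‖ + (m + 1) * δ)⁻¹ ≤
      ∑ i ∈ Finset.range j, ‖x + i • θ‖⁻¹ := by
  have hle : ∀ m ∈ Finset.range k, (m + 1) * q ≤ j := fun m hm =>
    (Nat.mul_le_mul_right q (Finset.mem_range.1 hm)).trans hkj
  have hinj : Set.InjOn (fun m => j - (m + 1) * q) (Finset.range k) := by
    intro a ha b hb hab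
    have h1 := hle a ha
    have h2 := hle b hb
    have h3 : (a + 1) * q = (b + 1) * q := by
      change j - (a + 1) * q = j - (b + 1) * q at hab
      omega
    have := Nat.eq_of_mul_eq_mul_right hq h3
    omega
  calc _ ≤ ∑ m ∈ Finset.range k, ‖x + (j - (m + 1) * q) • θ‖⁻¹ := by
        refine Finset.sum_le_sum fun m hm => inv_anti₀ (norm_pos_iff.2 (hx _)) ?_
        have h1 : x + (j - (m + 1) * q) • θ = (x + j • θ) - (m + 1) • (q • θ) := by
          rw [sub_nsmul _ (hle m hm), smul_smul]
          abel
        rw [h1]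
        refine (norm_sub_le _ _).trans ?_
        gcongr
        refine (norm_nsmul_le).trans ?_
        push_cast
        gcongr
    _ = ∑ i ∈ (Finset.range k).image fun m => j - (m + 1) * q, ‖x + i • θ‖⁻¹ :=
        (Finset.sum_image (f := fun i => ‖x + i • θ‖⁻¹) hinj).symm
    _ ≤ _ := by
        refine Finset.sum_le_sum_of_subset_of_nonneg ?_ fun _ _ _ => by positivity
        intro i hi
        obtain ⟨m, hm, rfl⟩ := Finset.mem_image.1 hi
        have h1 := hle m hm
        have h2 : 1 ≤ (m + 1) * q := Nat.mul_pos m.succ_pos hq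
        exact Finset.mem_range.2 (by omega)

theorem lt_mul_of_mul_sum_inv_lt {d δ K : ℝ} {N k : ℕ} (hδ : 0 ≤ δ) (hd : 0 < d)
    (hKN : 2 * K ≤ N) (hNk : N ≤ k)
    (h : d * ∑ m ∈ Finset.range k, (d + (m + 1) * δ)⁻¹ < K) : d < N * δ := by
  by_contra! hlt
  have h1 : ∑ m ∈ Finset.range N, (2 * d)⁻¹ ≤ ∑ m ∈ Finset.range k, (d + (m + 1) * δ)⁻¹ := by
    refine (Finset.sum_le_sum fun m hm => ?_).trans
      (Finset.sum_le_sum_of_subset_of_nonneg (Finset.range_subset_range.2 hNk)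
        fun _ _ _ => by positivity)
    have hm' : (m : ℝ) + 1 ≤ N := by exact_mod_cast Finset.mem_range.1 hm
    refine inv_anti₀ (by positivity) ?_
    nlinarith
  simp only [Finset.sum_const, Finset.card_range, nsmul_eq_mul] at h1
  have h2 : d * (N * (2 * d)⁻¹) = N / 2 := by field_simp
  nlinarith

theorem mul_log_lt_of_mul_sum_inv_lt {d δ K : ℝ} {N k : ℕ} (hδ : 0 < δ) (hd : 0 < d)
    (hdN : d < N * δ) (h : d * ∑ m ∈ Finset.range k, (d + (m + 1) * δ)⁻¹ < K) :
    d * Real.log ((k + (N + 1)) / (N + 1)) < K * δ := by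
  have h1 : δ⁻¹ * ∑ m ∈ Finset.range k, ((m : ℝ) + (N + 1))⁻¹ ≤
      ∑ m ∈ Finset.range k, (d + (m + 1) * δ)⁻¹ := by
    rw [Finset.mul_sum]
    refine Finset.sum_le_sum fun m _ => ?_
    rw [← mul_inv]
    refine inv_anti₀ (by positivity) ?_
    nlinarith
  have h2 := log_le_sum_range_inv (c := (N : ℝ) + 1) (by positivity) k
  calc d * Real.log ((k + (N + 1)) / (N + 1))
      ≤ d * ∑ m ∈ Finset.range k, ((m : ℝ) + (N + 1))⁻¹ := by gcongr
    _ = d * (δ⁻¹ * ∑ m ∈ Finset.range k, ((m : ℝ) + (N + 1))⁻¹) * δ := by field_simp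
    _ ≤ d * (∑ m ∈ Finset.range k, (d + (m + 1) * δ)⁻¹) * δ := by gcongr
    _ < K * δ := by gcongr

theorem UnitAddCircle.volume_le_ofReal_sum {s : Finset ℕ} {r : ℕ → ℝ} {θ : UnitAddCircle}
    {B : Set UnitAddCircle} (hr : ∀ j ∈ s, 0 ≤ r j)
    (hB : ∀ x ∈ B, ∃ j ∈ s, ‖x + j • θ‖ ≤ r j) :
    MeasureTheory.volume B ≤ ENNReal.ofReal (2 * ∑ j ∈ s, r j) := by
  have hsub : B ⊆ ⋃ j ∈ s, Metric.closedBall (-(j • θ)) (r j) := by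
    intro x hx
    obtain ⟨j, hj, h⟩ := hB x hx
    simp only [Set.mem_iUnion, mem_closedBall_iff_norm, sub_neg_eq_add]
    exact ⟨j, hj, h⟩
  calc _ ≤ _ := MeasureTheory.measure_mono hsub
    _ ≤ ∑ j ∈ s, MeasureTheory.volume (Metric.closedBall (-(j • θ)) (r j)) :=
        MeasureTheory.measure_biUnion_finset_le _ _
    _ ≤ ∑ j ∈ s, ENNReal.ofReal (2 * r j) := by
        refine Finset.sum_le_sum fun j _ => ?_
        rw [AddCircle.volume_closedBall]
        exact ENNReal.ofReal_le_ofReal (min_le_right _ _)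
    _ = _ := by
        rw [← ENNReal.ofReal_sum_of_nonneg fun j hj => by have := hr j hj; positivity,
          Finset.mul_sum]

/-- The points whose orbit under the rotation by `α` avoids `0` and for which at some time
`j ∈ [q, Q)` the ratio of the sum of the earlier reciprocal distances to the current reciprocal
distance is less than `K`. -/
def smallRatioSet (α : ℝ) (K q Q : ℕ) : Set UnitAddCircle :=
  {x | (∀ i : ℕ, x + i • (α : UnitAddCircle) ≠ 0) ∧ ∃ j ∈ Finset.Ico q Q,
    ‖x + j • (α : UnitAddCircle)‖ *
      ∑ i ∈ Finset.range j, ‖x + i • (α : UnitAddCircle)‖⁻¹ < K}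

theorem volume_smallRatioSet_le_of_log_le {α b : ℝ} {K q Q : ℕ} {p : ℤ} (hq : 4 ≤ q)
    (hqQ : q ≤ Q) (hpq : IsCoprime p (q : ℤ)) (hα : |q * α - p| ≤ 1 / Q)
    (hb : Real.log ((Q : ℝ) / q) ≤ b * Real.log q) :
    MeasureTheory.volume (smallRatioSet α K q Q) ≤ ENNReal.ofReal (16 * K * b) := by
  have hq4 : (4 : ℝ) ≤ q := by exact_mod_cast hq
  have hqQ' : (q : ℝ) ≤ Q := by exact_mod_cast hqQ
  have hM : 0 < Real.log q := Real.log_pos (by linarith)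
  have hα' : |q * α - p| ≤ 1 / q := hα.trans (by gcongr)
  refine (UnitAddCircle.volume_le_ofReal_sum (s := Finset.Ico q Q) (θ := (α : UnitAddCircle))
    (r := fun j => 4 * K / Real.log q * (j : ℝ)⁻¹) (fun _ _ => by positivity) ?_).trans ?_
  · rintro x ⟨hx, j, hj, h⟩
    refine ⟨j, hj, ?_⟩
    have hjq := (Finset.mem_Ico.1 hj).1
    have hj0 : (0 : ℝ) < j := by
      have : (q : ℝ) ≤ j := by exact_mod_cast hjq
      linarith
    have hS := mul_log_le_sum_range_inv_norm_of_le (by omega) hpq hα' x hx hjq hq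
    have h1 : ‖x + j • (α : UnitAddCircle)‖ * (j * Real.log q / 4) ≤ K :=
      (mul_le_mul_of_nonneg_left hS (norm_nonneg _)).trans h.le
    rw [← div_eq_mul_inv, div_div, le_div_iff₀ (by positivity)]
    linarith
  · refine ENNReal.ofReal_le_ofReal ?_
    rw [← Finset.mul_sum]
    have h1 := sum_Ico_inv_le_two_mul_log (show 1 ≤ q by omega) hqQ
    calc 2 * (4 * K / Real.log q * ∑ j ∈ Finset.Ico q Q, (j : ℝ)⁻¹)
        ≤ 2 * (4 * K / Real.log q * (2 * (b * Real.log q))) := by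
          gcongr
          exact h1.trans (by gcongr)
      _ = 16 * K * b := by field_simp; ring

theorem volume_smallRatioSet_le_of_one_le {α b : ℝ} {K q Q : ℕ} {p : ℤ} (hq : 4 ≤ q)
    (hqQ : q ≤ Q) (hpq : IsCoprime p (q : ℤ)) (hα : |q * α - p| ≤ 1 / Q) (hb0 : 0 < b)
    (hbK : 4 * Real.log (2 * K + 1) * b ≤ 1) (hbq : 1 ≤ b * Real.log q)
    (hb : 1 ≤ b * Real.log ((Q : ℝ) / q)) :
    MeasureTheory.volume (smallRatioSet α K q Q) ≤
      ENNReal.ofReal ((16 * K ^ 2 + 24 * K) * b) := by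
  have hq4 : (4 : ℝ) ≤ q := by exact_mod_cast hq
  have hqQ' : (q : ℝ) ≤ Q := by exact_mod_cast hqQ
  have hQ0 : (0 : ℝ) < Q := by linarith
  set M := Real.log q with hMdef
  set L := Real.log ((Q : ℝ) / q) with hLdef
  have hM : 0 < M := Real.log_pos (by linarith)
  have hL : 0 < L := pos_of_mul_pos_right (one_pos.trans_le hb) hb0.le
  have hexpL : Real.exp L = Q / q := Real.exp_log (by positivity)
  have hKL : 4 * Real.log (2 * K + 1) ≤ L :=
    le_of_mul_le_mul_right ((hbK.trans hb).trans_eq (mul_comm _ _)) hb0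
  have hα' : |q * α - p| ≤ 1 / q := hα.trans (by gcongr)
  have hθ : ‖q • (α : UnitAddCircle)‖ ≤ 1 / Q := by
    have h1 : q • (α : UnitAddCircle) = ((q * α : ℝ) : UnitAddCircle) := by simp
    rw [h1]
    exact (UnitAddCircle.norm_coe_le_of_eq_intCast_add p (by ring)).trans hα
  set r₁ : ℝ := 4 * K / (q * M) with hr₁
  set r₂ : ℝ := 2 * K / Q with hr₂
  set r₃ : ℝ := 4 * K / (Q * L) with hr₃
  have h₁ : 0 ≤ r₁ := by positivity
  have h₂ : 0 ≤ r₂ := by positivity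
  have h₃ : 0 ≤ r₃ := by positivity
  refine (UnitAddCircle.volume_le_ofReal_sum (s := Finset.Ico q Q) (θ := (α : UnitAddCircle))
    (r := fun j => (if j < 2 * K * q then r₁ else 0) + (if (j : ℝ) < 2 * Q / L then r₂ else 0)
      + r₃) (fun j _ => by positivity) ?_).trans ?_
  · rintro x ⟨hx, j, hj, h⟩
    refine ⟨j, hj, ?_⟩
    have hjq := (Finset.mem_Ico.1 hj).1
    have hjq' : (q : ℝ) ≤ j := by exact_mod_cast hjq
    have hd := norm_pos_iff.2 (hx j)
    set d := ‖x + j • (α : UnitAddCircle)‖ with hddef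
    have hS := mul_log_le_sum_range_inv_norm_of_le (by omega) hpq hα' x hx hjq hq
    by_cases hj1 : j < 2 * K * q
    · have h1 : d * (q * M / 4) ≤ K := by
        refine le_trans ?_ h.le
        refine mul_le_mul_of_nonneg_left (le_trans ?_ hS) hd.le
        gcongr
      have h2 : d ≤ r₁ := by
        rw [hr₁, le_div_iff₀ (by positivity)]
        linarith
      rw [if_pos hj1]
      have : 0 ≤ (if (j : ℝ) < 2 * Q / L then r₂ else 0) := by positivity
      linarith
    · have hNk : 2 * K ≤ j / q := (Nat.le_div_iff_mul_le (by omega)).2 (by omega)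
      have hT := sum_range_inv_add_le_sum_range_inv_norm (by omega) hθ
        (Nat.div_mul_le_self j q) hx
      have h1 := (mul_le_mul_of_nonneg_left hT hd.le).trans_lt h
      have h2 := lt_mul_of_mul_sum_inv_lt (N := 2 * K) (by positivity) hd (by push_cast; rfl)
        hNk h1
      rw [if_neg hj1, zero_add]
      by_cases hj2 : (j : ℝ) < 2 * Q / L
      · rw [if_pos hj2]
        have h3 : ((2 * K : ℕ) : ℝ) * (1 / Q) = r₂ := by rw [hr₂]; push_cast; ring
        linarith
      · rw [if_neg hj2, zero_add]
        have h3 := mul_log_lt_of_mul_sum_inv_lt (by positivity) hd h2 h1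
        have h4 : Real.exp (L / 2) ≤ (j / q : ℕ) + ((2 * K : ℕ) + 1) := by
          have h5 : (j : ℝ) / q < (j / q : ℕ) + 1 := by
            rw [div_lt_iff₀ (by positivity)]
            have := Nat.lt_div_mul_add (a := j) (b := q) (by omega)
            rw [← Nat.succ_mul] at this
            exact_mod_cast this
          have h6 : L / 2 ≤ Real.exp (L / 2) := by linarith [Real.add_one_le_exp (L / 2)]
          have h7 : Real.exp (L / 2) * (L / 2) ≤ Q / q := by
            calc _ ≤ Real.exp (L / 2) * Real.exp (L / 2) := by gcongr
              _ = Q / q := by rw [← Real.exp_add, add_halves, hexpL]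
          have h8 : Real.exp (L / 2) ≤ j / q := by
            rw [le_div_iff₀ (by positivity)] at h7 ⊢
            rw [not_lt, div_le_iff₀ hL] at hj2
            have : Real.exp (L / 2) * q * L ≤ j * L := by linarith
            exact le_of_mul_le_mul_right this hL
          have : (0 : ℝ) ≤ (2 * K : ℕ) := by positivity
          linarith
        have h5 : L / 4 ≤ Real.log (((j / q : ℕ) + ((2 * K : ℕ) + 1)) / ((2 * K : ℕ) + 1)) := by
          rw [Real.log_div (by positivity) (by positivity)]
          have := (Real.le_log_iff_exp_le (by positivity)).2 h4
          push_cast at this ⊢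
          linarith
        have h6 : d * (L / 4) ≤ K * (1 / Q) := (mul_le_mul_of_nonneg_left h5 hd.le).trans h3.le
        rw [hr₃, le_div_iff₀ (by positivity)]
        rw [mul_one_div, le_div_iff₀ hQ0] at h6
        linarith
  · refine ENNReal.ofReal_le_ofReal ?_
    rw [Finset.sum_add_distrib, Finset.sum_add_distrib, ← Finset.sum_filter, ← Finset.sum_filter]
    simp only [Finset.sum_const, nsmul_eq_mul]
    have c₁ : (((Finset.Ico q Q).filter fun j => j < 2 * K * q).card : ℝ) ≤ 2 * K * q := by
      have : ((Finset.Ico q Q).filter fun j => j < 2 * K * q).card ≤ 2 * K * q :=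
        (Finset.card_le_card fun j hj => Finset.mem_range.2 (Finset.mem_filter.1 hj).2).trans_eq
          (Finset.card_range _)
      exact_mod_cast this
    have c₂ : (((Finset.Ico q Q).filter fun j : ℕ => (j : ℝ) < 2 * Q / L).card : ℝ) ≤
        4 * Q / L := by
      have h1 : ((Finset.Ico q Q).filter fun j : ℕ => (j : ℝ) < 2 * Q / L).card ≤
          ⌈2 * Q / L⌉₊ := by
        rw [← Finset.card_range ⌈2 * Q / L⌉₊]
        refine Finset.card_le_card fun j hj =>
          Finset.mem_range.2 (Nat.lt_ceil.2 (Finset.mem_filter.1 hj).2)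
      have h2 : (((Finset.Ico q Q).filter fun j : ℕ => (j : ℝ) < 2 * Q / L).card : ℝ) ≤
          (⌈2 * Q / L⌉₊ : ℝ) := by exact_mod_cast h1
      have h3 := Nat.ceil_lt_add_one (a := 2 * Q / L) (by positivity)
      have h4 : 1 ≤ 2 * Q / L := by
        rw [le_div_iff₀ hL]
        have h5 : L ≤ Q / q := by linarith [Real.add_one_le_exp L]
        have h6 : (Q : ℝ) / q ≤ Q := div_le_self hQ0.le (by linarith)
        linarith
      have h5 : 4 * Q / L = 2 * Q / L + 2 * Q / L := by ring
      linarith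
    have c₃ : ((Finset.Ico q Q).card : ℝ) ≤ Q := by
      rw [Nat.card_Ico]
      exact_mod_cast Nat.sub_le _ _
    have iM : M⁻¹ ≤ b := by rwa [inv_le_iff_one_le_mul₀ hM]
    have iL : L⁻¹ ≤ b := by rwa [inv_le_iff_one_le_mul₀ hL]
    calc _ ≤ 2 * (2 * K * q * r₁ + 4 * Q / L * r₂ + Q * r₃) := by gcongr
      _ = 16 * K ^ 2 * M⁻¹ + 24 * K * L⁻¹ := by
        rw [hr₁, hr₂, hr₃]
        field_simp
        ring
      _ ≤ 16 * K ^ 2 * b + 24 * K * b := by gcongr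
      _ = _ := by ring

/-- A sufficient condition, in terms of good rational approximations `p n / q n` of `α`, for the
reciprocal distances to `0` along almost every orbit of the rotation by `α` to be negligible
compared to their partial sums. -/
theorem ae_tendsto_inv_norm_div_sum_of_summable {α : ℝ} {q : ℕ → ℕ} {p : ℕ → ℤ} {b : ℕ → ℝ}
    (hq : Monotone q) (hqt : Filter.Tendsto q Filter.atTop Filter.atTop)
    (hpq : ∀ n, IsCoprime (p n) (q n : ℤ)) (hα : ∀ n, |q n * α - p n| ≤ 1 / q (n + 1))
    (hb : Summable b) (hb0 : ∀ᶠ n in Filter.atTop, 0 < b n)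
    (hbq : ∀ᶠ n in Filter.atTop, 1 ≤ b n * Real.log (q n))
    (hbQ : ∀ᶠ n in Filter.atTop, 1 ≤ b n * Real.log ((q (n + 1) : ℝ) / q n) ∨
      Real.log ((q (n + 1) : ℝ) / q n) ≤ b n * Real.log (q n)) :
    ∀ᵐ x : UnitAddCircle, Filter.Tendsto
      (fun j : ℕ => ‖x + j • (α : UnitAddCircle)‖⁻¹ /
        ∑ i ∈ Finset.range j, ‖x + i • (α : UnitAddCircle)‖⁻¹)
      Filter.atTop (nhds 0) := by
  have horbit : ∀ᵐ x : UnitAddCircle, ∀ i : ℕ, x + i • (α : UnitAddCircle) ≠ 0 := by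
    rw [MeasureTheory.ae_all_iff]
    intro i
    have : MeasureTheory.volume ({-(i • (α : UnitAddCircle))} : Set UnitAddCircle) = 0 := by
      rw [← Metric.closedBall_zero, AddCircle.volume_closedBall]
      simp
    filter_upwards [MeasureTheory.measure_eq_zero_iff_ae_notMem.1 this] with x hx h
    exact hx (eq_neg_of_add_eq_zero_left h)
  have hmain : ∀ᵐ x : UnitAddCircle, ∀ K : ℕ, ∀ᶠ n in Filter.atTop,
      x ∉ smallRatioSet α K (q n) (q (n + 1)) := by
    rw [MeasureTheory.ae_all_iff]
    intro K
    have hbK : ∀ᶠ n in Filter.atTop, 4 * Real.log (2 * K + 1) * b n ≤ 1 := by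
      have h1 := hb.tendsto_atTop_zero.const_mul (4 * Real.log (2 * K + 1))
      rw [mul_zero] at h1
      exact h1.eventually_le_const one_pos
    obtain ⟨n₀, hn₀⟩ := Filter.eventually_atTop.1 (hb0.and (hbq.and (hbQ.and (hbK.and
      (hqt.eventually_ge_atTop 4)))))
    have hvol : ∀ n, MeasureTheory.volume (smallRatioSet α K (q (n + n₀)) (q (n + n₀ + 1))) ≤
        ENNReal.ofReal ((16 * K ^ 2 + 24 * K) * b (n + n₀)) := by
      intro n
      obtain ⟨h1, h2, h3 | h3, h4, h5⟩ := hn₀ (n + n₀) (by omega)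
      · exact volume_smallRatioSet_le_of_one_le h5 (hq (Nat.le_succ _)) (hpq _) (hα _) h1 h4 h2 h3
      · refine (volume_smallRatioSet_le_of_log_le h5 (hq (Nat.le_succ _)) (hpq _) (hα _)
          h3).trans (ENNReal.ofReal_le_ofReal ?_)
        gcongr
        nlinarith [sq_nonneg (K : ℝ), (Nat.cast_nonneg K : (0 : ℝ) ≤ K)]
    have hsum : Summable fun n => (16 * (K : ℝ) ^ 2 + 24 * K) * b (n + n₀) :=
      ((summable_nat_add_iff n₀).2 hb).mul_left _
    have hfin : ∑' n, MeasureTheory.volume (smallRatioSet α K (q (n + n₀)) (q (n + n₀ + 1))) ≠ ⊤ :=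
      ne_top_of_le_ne_top hsum.tsum_ofReal_ne_top (ENNReal.tsum_le_tsum hvol)
    filter_upwards [MeasureTheory.ae_eventually_notMem hfin] with x hx
    obtain ⟨n₁, hn₁⟩ := Filter.eventually_atTop.1 hx
    refine Filter.eventually_atTop.2 ⟨n₁ + n₀, fun n hn => ?_⟩
    simpa only [Nat.sub_add_cancel (show n₀ ≤ n by omega)] using hn₁ (n - n₀) (by omega)
  filter_upwards [horbit, hmain] with x hx hxK
  rw [Metric.tendsto_atTop]
  intro ε hε
  obtain ⟨K, hK⟩ := exists_nat_gt (1 / ε)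
  obtain ⟨n₀, hn₀⟩ := Filter.eventually_atTop.1 (hxK K)
  refine ⟨q n₀, fun j hj => ?_⟩
  have hex : ∃ n, j < q n := (hqt.eventually_gt_atTop j).exists
  obtain ⟨n, hn, hjn, hjn'⟩ : ∃ n, n₀ ≤ n ∧ q n ≤ j ∧ j < q (n + 1) := by
    have hlt : n₀ < Nat.find hex := by
      by_contra! h
      exact absurd (Nat.find_spec hex) (not_lt.2 ((hq h).trans hj))
    refine ⟨Nat.find hex - 1, by omega, not_lt.1 (Nat.find_min hex (by omega)), ?_⟩
    rw [Nat.sub_add_cancel (by omega)]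
    exact Nat.find_spec hex
  have hnot := hn₀ n hn
  have hge : (K : ℝ) ≤ ‖x + j • (α : UnitAddCircle)‖ *
      ∑ i ∈ Finset.range j, ‖x + i • (α : UnitAddCircle)‖⁻¹ := by
    by_contra! h
    exact hnot ⟨hx, j, Finset.mem_Ico.2 ⟨hjn, hjn'⟩, h⟩
  have hKpos : 0 < (K : ℝ) := (by positivity : 0 < 1 / ε).trans hK
  rw [Real.dist_0_eq_abs, abs_of_nonneg (by positivity), div_eq_mul_inv, ← mul_inv]
  refine (inv_anti₀ hKpos hge).trans_lt ?_
  rwa [inv_lt_comm₀ hKpos hε, inv_eq_one_div]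

theorem irrational_cfQuot {α : ℝ} (hα : Irrational α) (n : ℕ) : Irrational (cfQuot α n) := by
  induction n with
  | zero => exact hα
  | succ n ih => exact (ih.sub_intCast _).inv

theorem cfQuot_sub_floor_pos {α : ℝ} (hα : Irrational α) (n : ℕ) :
    0 < cfQuot α n - ⌊cfQuot α n⌋ :=
  sub_pos.2 (lt_of_le_of_ne (Int.floor_le _) ((irrational_cfQuot hα n).ne_int _).symm)

theorem one_lt_cfQuot_succ {α : ℝ} (hα : Irrational α) (n : ℕ) : 1 < cfQuot α (n + 1) :=
  (one_lt_inv₀ (cfQuot_sub_floor_pos hα n)).2 (by linarith [Int.lt_floor_add_one (cfQuot α n)])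

theorem cfa_succ_cast {α : ℝ} (hα : Irrational α) (n : ℕ) :
    (cfa α (n + 1) : ℝ) = ⌊cfQuot α (n + 1)⌋ := by
  have h : (cfa α (n + 1) : ℤ) = ⌊cfQuot α (n + 1)⌋ :=
    Int.toNat_of_nonneg (Int.floor_nonneg.2 (one_pos.trans (one_lt_cfQuot_succ hα n)).le)
  exact_mod_cast h

theorem one_le_cfa_succ {α : ℝ} (hα : Irrational α) (n : ℕ) : 1 ≤ cfa α (n + 1) := by
  have h : (1 : ℤ) ≤ ⌊cfQuot α (n + 1)⌋ :=
    Int.le_floor.2 (by exact_mod_cast (one_lt_cfQuot_succ hα n).le)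
  have h1 : (1 : ℝ) ≤ cfa α (n + 1) := by
    rw [cfa_succ_cast hα]
    exact_mod_cast h
  exact_mod_cast h1

theorem cfQuot_succ_succ_mul {α : ℝ} (hα : Irrational α) (n : ℕ) :
    cfQuot α (n + 2) * (cfQuot α (n + 1) - cfa α (n + 1)) = 1 := by
  rw [cfa_succ_cast hα]
  exact inv_mul_cancel₀ (cfQuot_sub_floor_pos hα (n + 1)).ne'

theorem one_le_cfq {α : ℝ} (hα : Irrational α) (n : ℕ) : 1 ≤ cfq α n := by
  induction n using Nat.twoStepInduction with
  | zero => exact le_rfl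
  | one => exact one_le_cfa_succ hα 0
  | more n ih _ => exact ih.trans (Nat.le_add_left _ _)

theorem cfa_mul_cfq_le (α : ℝ) (n : ℕ) : cfa α (n + 1) * cfq α n ≤ cfq α (n + 1) := by
  cases n with
  | zero => exact (mul_one _).le
  | succ n => exact Nat.le_add_right _ _

theorem monotone_cfq {α : ℝ} (hα : Irrational α) : Monotone (cfq α) :=
  monotone_nat_of_le_succ fun n =>
    (Nat.le_mul_of_pos_left _ (one_le_cfa_succ hα n)).trans (cfa_mul_cfq_le α n)

theorem le_cfq {α : ℝ} (hα : Irrational α) (n : ℕ) : n ≤ cfq α n := by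
  induction n using Nat.twoStepInduction with
  | zero => exact Nat.zero_le _
  | one => exact one_le_cfq hα 1
  | more n _ ih =>
    have h1 : cfq α (n + 1) ≤ cfa α (n + 2) * cfq α (n + 1) :=
      Nat.le_mul_of_pos_left _ (one_le_cfa_succ hα (n + 1))
    have h2 := one_le_cfq hα n
    change n + 2 ≤ cfa α (n + 2) * cfq α (n + 1) + cfq α n
    omega

theorem cfp_mul_cfq_sub (α : ℝ) (n : ℕ) :
    cfp α (n + 1) * cfq α n - cfp α n * cfq α (n + 1) = (-1) ^ n := by
  induction n with
  | zero => simp [cfp, cfq]; ring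
  | succ n ih =>
    simp only [cfp, cfq, pow_succ] at ih ⊢
    push_cast
    linear_combination -ih

theorem isCoprime_cfp_cfq (α : ℝ) (n : ℕ) : IsCoprime (cfp α n) (cfq α n : ℤ) := by
  refine ⟨-(-1) ^ n * cfq α (n + 1), (-1) ^ n * cfp α (n + 1), ?_⟩
  have h : ((-1 : ℤ) ^ n) * (-1) ^ n = 1 := by rw [← mul_pow]; simp
  linear_combination (-1) ^ n * cfp_mul_cfq_sub α n + h

theorem cfrho_succ_mul_cfQuot {α : ℝ} (hα : Irrational α) (n : ℕ) :
    cfrho α (n + 1) * cfQuot α (n + 2) = -cfrho α n := by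
  induction n with
  | zero =>
    have h1 := cfQuot_succ_succ_mul hα 0
    have h2 : cfQuot α 1 * (α - ⌊α⌋) = 1 := inv_mul_cancel₀ (cfQuot_sub_floor_pos hα 0).ne'
    simp only [cfrho, cfp, cfq, zero_add] at h1 ⊢
    push_cast
    linear_combination (-(α - ⌊α⌋)) * h1 + cfQuot α 2 * h2
  | succ n ih =>
    have h1 := cfQuot_succ_succ_mul hα (n + 1)
    have h3 : cfrho α (n + 2) = cfa α (n + 2) * cfrho α (n + 1) + cfrho α n := by
      simp only [cfrho, cfp, cfq]
      push_cast
      ring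
    rw [show n + 1 + 1 = n + 2 from rfl, h3]
    linear_combination (-cfrho α (n + 1)) * h1 + cfQuot α (n + 3) * ih

theorem abs_cfq_mul_sub_cfp_le {α : ℝ} (hα : Irrational α) (n : ℕ) :
    |cfq α n * α - cfp α n| ≤ 1 / cfq α (n + 1) := by
  have hq : (0 : ℝ) < cfq α (n + 1) := by exact_mod_cast one_le_cfq hα (n + 1)
  rw [le_div_iff₀ hq]
  have hdet : ((cfp α (n + 1) * cfq α n - cfp α n * cfq α (n + 1) : ℤ) : ℝ) = (-1) ^ n := by
    rw [cfp_mul_cfq_sub]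
    push_cast
    rfl
  push_cast at hdet
  have hx := one_lt_cfQuot_succ hα (n + 1)
  have hrho := cfrho_succ_mul_cfQuot hα n
  have hq0 : (0 : ℝ) ≤ cfq α n := by positivity
  have habs : |cfq α n * cfrho α (n + 1) - cfq α (n + 1) * cfrho α n| = 1 := by
    have : cfq α n * cfrho α (n + 1) - cfq α (n + 1) * cfrho α n = -(-1) ^ n := by
      simp only [cfrho]
      linear_combination -hdet
    rw [this]
    simp
  have hfac : cfq α n * cfrho α (n + 1) - cfq α (n + 1) * cfrho α n =
      cfrho α (n + 1) * (cfq α n + cfq α (n + 1) * cfQuot α (n + 2)) := by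
    linear_combination (-(cfq α (n + 1) : ℝ)) * hrho
  have hpos : 0 ≤ cfq α n + cfq α (n + 1) * cfQuot α (n + 2) := by positivity
  change |cfrho α n| * _ ≤ 1
  rw [hfac, abs_mul, abs_of_nonneg hpos] at habs
  have hrho' : |cfrho α n| = |cfrho α (n + 1)| * cfQuot α (n + 2) := by
    rw [← abs_neg (cfrho α n), ← hrho, abs_mul, abs_of_pos (by linarith : 0 < cfQuot α (n + 2))]
  rw [hrho', ← habs]
  nlinarith [mul_nonneg (abs_nonneg (cfrho α (n + 1))) hq0]

theorem summable_one_div_log_cfq {α : ℝ} (hα : Irrational α) (ha : ∀ n : ℕ, 1 ≤ n → 2 ≤ cfa α n)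
    (hs : Summable fun n : ℕ => 1 / Real.log (cfa α (n + 1))) :
    Summable fun n : ℕ => 1 / Real.log (cfq α n) := by
  rw [← summable_nat_add_iff 1]
  refine Summable.of_nonneg_of_le (fun n => ?_) (fun n => ?_) hs
  · exact one_div_nonneg.2 (Real.log_natCast_nonneg _)
  · have h1 : (2 : ℝ) ≤ cfa α (n + 1) := by exact_mod_cast ha (n + 1) (by omega)
    have h2 : (cfa α (n + 1) : ℝ) ≤ cfq α (n + 1) := by
      exact_mod_cast (Nat.le_mul_of_pos_right _ (one_le_cfq hα n)).trans (cfa_mul_cfq_le α n)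
    have h3 : 0 < Real.log (cfa α (n + 1)) := Real.log_pos (by linarith)
    gcongr

theorem summable_one_div_sqrt_log {q : ℕ → ℝ} {C γ : ℝ} (hC : 0 < C) (hγ : 0 < γ)
    (h : ∀ n : ℕ, C * Real.exp ((n : ℝ) ^ (2 + γ)) ≤ q n) :
    Summable fun n : ℕ => 1 / √(Real.log (q n)) := by
  have hp : Summable fun n : ℕ => 2 * (1 / (n : ℝ) ^ (1 + γ / 2)) :=
    (Real.summable_one_div_nat_rpow.2 (by linarith)).mul_left 2
  refine Summable.of_norm_bounded_eventually_nat hp ?_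
  have hlim : Filter.Tendsto (fun n : ℕ => (n : ℝ) ^ (2 + γ)) Filter.atTop Filter.atTop :=
    (tendsto_rpow_atTop (by linarith)).comp tendsto_natCast_atTop_atTop
  filter_upwards [hlim.eventually_ge_atTop (-2 * Real.log C), Filter.eventually_ge_atTop 1]
    with n hn hn1
  have hn0 : (0 : ℝ) < n := by exact_mod_cast hn1
  have h1 : Real.log C + (n : ℝ) ^ (2 + γ) ≤ Real.log (q n) := by
    rw [← Real.log_exp ((n : ℝ) ^ (2 + γ)), ← Real.log_mul hC.ne' (Real.exp_pos _).ne']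
    exact Real.log_le_log (by positivity) (h n)
  have h2 : ((n : ℝ) ^ (1 + γ / 2)) ^ 2 = (n : ℝ) ^ (2 + γ) := by
    rw [← Real.rpow_natCast, ← Real.rpow_mul hn0.le]
    congr 1
    push_cast
    ring
  have h3 : 0 < (n : ℝ) ^ (2 + γ) := by positivity
  have h4 : (n : ℝ) ^ (1 + γ / 2) / 2 ≤ √(Real.log (q n)) := by
    refine Real.le_sqrt_of_sq_le ?_
    rw [div_pow, h2]
    linarith
  rw [Real.norm_of_nonneg (by positivity)]
  calc 1 / √(Real.log (q n)) ≤ 1 / ((n : ℝ) ^ (1 + γ / 2) / 2) := by gcongr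
    _ = _ := by field_simp

open Filter

/-- Let `α` be irrational and suppose that either
`Σ_{n ≥ 1} 1/log aₙ < ∞` (which entails `aₙ ≥ 2` for all `n ≥ 1`), or there
are `C, γ > 0` with `qₙ ≥ C exp(n^{2+γ})` for every `n`.  Then for Haar-almost
every `x ∈ T`, `‖x + jα‖⁻¹ / Σ_{i<j} ‖x + iα‖⁻¹ → 0` as `j → ∞`. -/
theorem stmt_17 (α : ℝ) (hα : Irrational α)
    (h : ((∀ n : ℕ, 1 ≤ n → 2 ≤ cfa α n) ∧
          Summable (fun n : ℕ => 1 / Real.log ((cfa α (n + 1) : ℝ)))) ∨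
        (∃ C > (0 : ℝ), ∃ γ > (0 : ℝ), ∀ n : ℕ,
          C * Real.exp ((n : ℝ) ^ (2 + γ)) ≤ (cfq α n : ℝ))) :
    ∀ᵐ x : UnitAddCircle, Tendsto
      (fun j : ℕ => ‖x + j • (α : UnitAddCircle)‖⁻¹ /
        ∑ i ∈ Finset.range j, ‖x + i • (α : UnitAddCircle)‖⁻¹)
      atTop (nhds 0) := by
  have hqt : Tendsto (cfq α) atTop atTop := tendsto_atTop_mono (le_cfq hα) tendsto_id
  have hlog : Tendsto (fun n => Real.log (cfq α n)) atTop atTop :=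
    Real.tendsto_log_atTop.comp (tendsto_natCast_atTop_atTop.comp hqt)
  rcases h with ⟨ha, hs⟩ | ⟨C, hC, γ, hγ, hq⟩
  · have hapos : ∀ n, 0 < Real.log (cfa α (n + 1)) := fun n =>
      Real.log_pos (by exact_mod_cast ha (n + 1) (by omega))
    refine ae_tendsto_inv_norm_div_sum_of_summable (monotone_cfq hα) hqt (isCoprime_cfp_cfq α)
      (abs_cfq_mul_sub_cfp_le hα) (hs.add (summable_one_div_log_cfq hα ha hs)) ?_ ?_ ?_
    · filter_upwards [hlog.eventually_gt_atTop 0] with n hn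
      have := hapos n
      positivity
    · filter_upwards [hlog.eventually_gt_atTop 0] with n hn
      have := hapos n
      rw [add_mul, one_div_mul_cancel hn.ne']
      exact le_add_of_nonneg_left (by positivity)
    · filter_upwards [hlog.eventually_gt_atTop 0] with n hn
      left
      have h1 := hapos n
      have h2 : Real.log (cfa α (n + 1)) ≤ Real.log ((cfq α (n + 1) : ℝ) / cfq α n) := by
        have h3 : (0 : ℝ) < cfq α n := by exact_mod_cast one_le_cfq hα n
        have h4 : (0 : ℝ) < cfa α (n + 1) := by exact_mod_cast one_le_cfa_succ hα n
        refine Real.log_le_log h4 ?_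
        rw [le_div_iff₀ h3]
        exact_mod_cast cfa_mul_cfq_le α n
      calc (1 : ℝ) = 1 / Real.log (cfa α (n + 1)) * Real.log (cfa α (n + 1)) :=
            (one_div_mul_cancel h1.ne').symm
        _ ≤ _ := by
          gcongr
          exact le_add_of_nonneg_right (by positivity)
  · refine ae_tendsto_inv_norm_div_sum_of_summable (monotone_cfq hα) hqt (isCoprime_cfp_cfq α)
      (abs_cfq_mul_sub_cfp_le hα) (summable_one_div_sqrt_log hC hγ hq) ?_ ?_ ?_
    · filter_upwards [hlog.eventually_gt_atTop 0] with n hn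
      positivity
    · filter_upwards [hlog.eventually_ge_atTop 1] with n hn
      rw [one_div_mul_eq_div, Real.div_sqrt]
      exact Real.one_le_sqrt.2 hn
    · filter_upwards [hlog.eventually_gt_atTop 0] with n hn
      rw [one_div_mul_eq_div, one_div_mul_eq_div, Real.div_sqrt, one_le_div (by positivity)]
      exact le_total _ _
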